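/- (Cavity streaming equation.) Fix an integer s ≥ 1 and let F be a bounded measurable function of the overlap arrays ((q_{ab})_{1≤a<b≤s}, (q̃_{ab})_{1≤a<b≤s}) of the first s replicas. Then for every t > 0 the map t ↦ ⟨F⟩_t is differentiable and d/dt ⟨F⟩_t = ⟨F · ( Σ_{1≤a<b≤s} q_{ab}q̃_{ab} − s Σ_{a=1}^{s} q_{a,s+1}q̃_{a,s+1} + (s(s+1)/2) q_{s+1,s+2}q̃_{s+1,s+2} )⟩_t, where the right-hand side is evaluated with s+2 replicas. -/

import Mathlib

open MeasureTheory ProbabilityTheory Filter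

noncomputable section

/-- spin value of a Boolean configuration coordinate: `±1`. -/
def spinval (b : Bool) : ℝ := if b then 1 else -1

/-- Joint law of the two independent i.i.d. standard Gaussian families `(Ĵ, J̃)`. -/
def couplingLaw (N M : ℕ) :
    Measure (((Fin M × Fin M) → ℝ) × ((Fin N × Fin M) → ℝ)) :=
  (Measure.pi fun _ : Fin M × Fin M => gaussianReal 0 1).prod
    (Measure.pi fun _ : Fin N × Fin M => gaussianReal 0 1)

/-- Random Gibbs weight on a pair `(σ, τ)`:
`ξ_τ · exp(√(t/(NM)) Σ_{i,k} J̃_{ik} τ_k σ_i)` with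
`ξ_τ = exp((β/√M) Σ_{k,l} Ĵ_{kl} τ_k τ_l)`. -/
def cavityWeight (N M : ℕ) (β t : ℝ)
    (J : ((Fin M × Fin M) → ℝ) × ((Fin N × Fin M) → ℝ))
    (στ : (Fin N → Bool) × (Fin M → Bool)) : ℝ :=
  Real.exp ((β / Real.sqrt M) * ∑ k : Fin M, ∑ l : Fin M,
      J.1 (k, l) * spinval (στ.2 k) * spinval (στ.2 l)
    + Real.sqrt (t / ((N : ℝ) * (M : ℝ))) * ∑ i : Fin N, ∑ k : Fin M,
      J.2 (i, k) * spinval (στ.2 k) * spinval (στ.1 i))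

/-- Partition function of the cavity Gibbs measure. -/
def cavityZ (N M : ℕ) (β t : ℝ)
    (J : ((Fin M × Fin M) → ℝ) × ((Fin N × Fin M) → ℝ)) : ℝ :=
  ∑ στ : (Fin N → Bool) × (Fin M → Bool), cavityWeight N M β t J στ

/-- Quenched replicated Gibbs average `⟨f⟩_t = E[Ω_t(f)]` over `n` replicas. -/
def replicaAvg (n N M : ℕ) (β t : ℝ)
    (f : (Fin n → (Fin N → Bool) × (Fin M → Bool)) → ℝ) : ℝ :=
  ∫ J, (∑ R : Fin n → (Fin N → Bool) × (Fin M → Bool),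
      (∏ a : Fin n, cavityWeight N M β t J (R a)) * f R) / (cavityZ N M β t J) ^ n
    ∂(couplingLaw N M)

/-- Overlap `(1/N) Σ_i σ_i σ'_i` of two spin configurations. -/
def ovlp (N : ℕ) (σ σ' : Fin N → Bool) : ℝ :=
  (1 / (N : ℝ)) * ∑ i : Fin N, spinval (σ i) * spinval (σ' i)

/-- Gaussian integration by parts on the real line. -/
theorem integral_id_mul_gaussianReal {f f' : ℝ → ℝ} (hf : ∀ x, HasDerivAt f (f' x) x)
    (hfi : Integrable f (gaussianReal 0 1)) (hxf : Integrable (fun x => x * f x) (gaussianReal 0 1))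
    (hf'i : Integrable f' (gaussianReal 0 1)) :
    ∫ x, x * f x ∂gaussianReal 0 1 = ∫ x, f' x ∂gaussianReal 0 1 := by
  have density : ∀ {g : ℝ → ℝ}, Integrable g (gaussianReal 0 1) →
      Integrable (fun x => gaussianPDFReal 0 1 x * g x) := by
    intro g hg
    rw [gaussianReal_of_var_ne_zero 0 one_ne_zero,
      integrable_withDensity_iff_integrable_smul' (measurable_gaussianPDF 0 1)
        (ae_of_all _ fun _ => gaussianPDF_lt_top)] at hg
    simpa [toReal_gaussianPDF] using hg
  have hpdf : ∀ x, HasDerivAt (fun x => -gaussianPDFReal 0 1 x) (x * gaussianPDFReal 0 1 x) x := by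
    intro x
    have hfun : (fun x => -gaussianPDFReal 0 1 x) =
        fun y => -((Real.sqrt (2 * Real.pi))⁻¹ * Real.exp (-y ^ 2 / 2)) := by
      funext y
      simp [gaussianPDFReal_def]
    rw [hfun]
    refine ((((hasDerivAt_pow 2 x).fun_neg.div_const 2).exp).const_mul
      (Real.sqrt (2 * Real.pi))⁻¹).fun_neg.congr_deriv ?_
    simp [gaussianPDFReal_def]
    ring
  have h := integral_mul_deriv_eq_deriv_mul_of_integrable (u := f) (u' := f')
    (v := fun x => -gaussianPDFReal 0 1 x) (v' := fun x => x * gaussianPDFReal 0 1 x)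
    (fun x _ => hf x) (fun x _ => hpdf x)
    ((density hxf).congr (ae_of_all _ fun x => by simp only [Pi.mul_apply]; ring))
    ((density hf'i).neg.congr (ae_of_all _ fun x => by simp only [Pi.mul_apply, Pi.neg_apply]; ring))
    ((density hfi).neg.congr (ae_of_all _ fun x => by simp only [Pi.mul_apply, Pi.neg_apply]; ring))
  rw [integral_gaussianReal_eq_integral_smul one_ne_zero,
    integral_gaussianReal_eq_integral_smul one_ne_zero]
  calc ∫ x, gaussianPDFReal 0 1 x • (x * f x) = ∫ x, f x * (x * gaussianPDFReal 0 1 x) := by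
        congr 1; funext x; simp only [smul_eq_mul]; ring
    _ = -∫ x, f' x * -gaussianPDFReal 0 1 x := h
    _ = ∫ x, gaussianPDFReal 0 1 x • f' x := by
        rw [← integral_neg]; congr 1; funext x; simp only [smul_eq_mul]; ring

/-- Resampling one coordinate of a product probability measure preserves it. -/
theorem measurePreserving_update {ι : Type*} [Fintype ι] [DecidableEq ι] {X : ι → Type*}
    [∀ i, MeasurableSpace (X i)] (μ : ∀ i, Measure (X i)) [∀ i, IsProbabilityMeasure (μ i)]
    (j : ι) :
    MeasurePreserving (fun p : (∀ i, X i) × X j => Function.update p.1 j p.2)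
      ((Measure.pi μ).prod (μ j)) (Measure.pi μ) := by
  have hmeas : Measurable (fun p : (∀ i, X i) × X j => Function.update p.1 j p.2) := by
    rw [measurable_pi_iff]
    intro i
    by_cases hij : i = j
    · subst hij
      simpa using measurable_snd
    · simp only [Function.update_of_ne hij]
      exact (measurable_pi_apply i).comp measurable_fst
  refine ⟨hmeas, (Measure.pi_eq fun s hs => ?_).symm⟩
  rw [Measure.map_apply hmeas (MeasurableSet.univ_pi hs)]
  have hpre : (fun p : (∀ i, X i) × X j => Function.update p.1 j p.2) ⁻¹' Set.pi Set.univ s =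
      (Set.pi Set.univ (Function.update s j Set.univ)) ×ˢ s j := by
    ext ⟨x, y⟩
    simp only [Set.mem_preimage, Set.mem_pi, Set.mem_univ, true_imp_iff, Set.mem_prod]
    constructor
    · refine fun h => ⟨fun i => ?_, by simpa using h j⟩
      by_cases hij : i = j
      · subst hij; simp
      · simpa [Function.update_of_ne hij] using h i
    · rintro ⟨h, hy⟩ i
      by_cases hij : i = j
      · subst hij; simpa using hy
      · simpa [Function.update_of_ne hij] using h i
  rw [hpre, Measure.prod_prod, Measure.pi_pi, ← Finset.mul_prod_erase _ _ (Finset.mem_univ j),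
    ← Finset.mul_prod_erase _ (fun i => μ i (s i)) (Finset.mem_univ j), mul_comm]
  simp only [Function.update_self, measure_univ, one_mul]
  congr 1
  exact Finset.prod_congr rfl fun i hi => by rw [Function.update_of_ne (Finset.ne_of_mem_erase hi)]

theorem integrable_apply_pi_gaussianReal {ι : Type*} [Fintype ι] (j : ι) :
    Integrable (fun x : ι → ℝ => x j) (Measure.pi fun _ : ι => gaussianReal 0 1) :=
  (measurePreserving_eval (fun _ : ι => gaussianReal 0 1) j).integrable_comp_of_integrable
    (g := fun x : ℝ => x) ((memLp_id_gaussianReal 1).integrable le_rfl)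

/-- Gaussian integration by parts in one coordinate of a standard Gaussian vector. -/
theorem integral_apply_mul_pi_gaussianReal {ι : Type*} [Fintype ι] [DecidableEq ι] (j : ι)
    {Φ Φ' : (ι → ℝ) → ℝ} (hΦ : Measurable Φ) (hΦ' : Measurable Φ') {C : ℝ}
    (hC : ∀ x, |Φ x| ≤ C) (hC' : ∀ x, |Φ' x| ≤ C)
    (hderiv : ∀ x, HasDerivAt (fun y => Φ (Function.update x j y)) (Φ' x) (x j)) :
    ∫ x, x j * Φ x ∂(Measure.pi fun _ : ι => gaussianReal 0 1) =
      ∫ x, Φ' x ∂(Measure.pi fun _ : ι => gaussianReal 0 1) := by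
  have hmp := measurePreserving_update (fun _ : ι => gaussianReal 0 1) j
  have hprodInt : Integrable (fun x : ι → ℝ => x j * Φ x)
      (Measure.pi fun _ : ι => gaussianReal 0 1) :=
    (integrable_apply_pi_gaussianReal j).mul_bdd hΦ.aestronglyMeasurable
      (ae_of_all _ fun x => hC x)
  have hprodInt' : Integrable Φ' (Measure.pi fun _ : ι => gaussianReal 0 1) :=
    Integrable.of_bound hΦ'.aestronglyMeasurable C (ae_of_all _ fun x => hC' x)
  have hfubini : ∀ {g : (ι → ℝ) → ℝ}, Integrable g (Measure.pi fun _ : ι => gaussianReal 0 1) →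
      ∫ x, g x ∂(Measure.pi fun _ : ι => gaussianReal 0 1) =
        ∫ x, ∫ y, g (Function.update x j y) ∂gaussianReal 0 1
          ∂(Measure.pi fun _ : ι => gaussianReal 0 1) := by
    intro g hg
    have hg' := hg
    rw [← hmp.map_eq] at hg'
    rw [← integral_prod (fun p : (ι → ℝ) × ℝ => g (Function.update p.1 j p.2))
      (hmp.integrable_comp_of_integrable hg), ← integral_map hmp.aemeasurable hg'.1, hmp.map_eq]
  rw [hfubini hprodInt, hfubini hprodInt']
  congr 1
  funext x
  have hder : ∀ y, HasDerivAt (fun y => Φ (Function.update x j y))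
      (Φ' (Function.update x j y)) y := by
    intro y
    simpa using hderiv (Function.update x j y)
  have hupd : Measurable (fun y : ℝ => Function.update x j y) := measurable_update x
  have hfi : ∀ {g : (ι → ℝ) → ℝ}, Measurable g → (∀ x, |g x| ≤ C) →
      Integrable (fun y => g (Function.update x j y)) (gaussianReal 0 1) := fun hg hb =>
    Integrable.of_bound (hg.comp hupd).aestronglyMeasurable C (ae_of_all _ fun y => hb _)
  simp only [Function.update_self]
  refine integral_id_mul_gaussianReal hder (hfi hΦ hC) ?_ (hfi hΦ' hC')
  exact ((memLp_id_gaussianReal 1).integrable le_rfl).mul_bdd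
    (hΦ.comp hupd).aestronglyMeasurable (ae_of_all _ fun y => hC _)

/-- Gaussian integration by parts in the presence of independent extra randomness. -/
theorem integral_apply_mul_prod_pi_gaussianReal {α ι : Type*} [MeasurableSpace α] [Fintype ι]
    [DecidableEq ι] (μ : Measure α) [IsProbabilityMeasure μ] (j : ι)
    {Φ Φ' : α × (ι → ℝ) → ℝ} (hΦ : Measurable Φ) (hΦ' : Measurable Φ') {C : ℝ}
    (hC : ∀ p, |Φ p| ≤ C) (hC' : ∀ p, |Φ' p| ≤ C)
    (hderiv : ∀ p, HasDerivAt (fun y => Φ (p.1, Function.update p.2 j y)) (Φ' p) (p.2 j)) :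
    ∫ p, p.2 j * Φ p ∂(μ.prod (Measure.pi fun _ : ι => gaussianReal 0 1)) =
      ∫ p, Φ' p ∂(μ.prod (Measure.pi fun _ : ι => gaussianReal 0 1)) := by
  have hprodInt : Integrable (fun p : α × (ι → ℝ) => p.2 j)
      (μ.prod (Measure.pi fun _ : ι => gaussianReal 0 1)) :=
    (integrable_apply_pi_gaussianReal j).comp_snd μ
  rw [integral_prod _ (hprodInt.mul_bdd hΦ.aestronglyMeasurable (ae_of_all _ fun p => hC p)),
    integral_prod _ (Integrable.of_bound hΦ'.aestronglyMeasurable C (ae_of_all _ fun p => hC' p))]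
  congr 1
  funext a
  exact integral_apply_mul_pi_gaussianReal j (hΦ.comp measurable_prodMk_left)
    (hΦ'.comp measurable_prodMk_left) (fun x => hC (a, x)) (fun x => hC' (a, x))
    fun x => hderiv (a, x)

section Gibbs

variable {S : Type*}

/-- Average over `n` independent replicas of the Gibbs measure with weight `w`. -/
def gibbsAvg [Fintype S] (n : ℕ) (w : S → ℝ) (f : (Fin n → S) → ℝ) : ℝ :=
  (∑ R : Fin n → S, (∏ a : Fin n, w (R a)) * f R) / (∑ σ, w σ) ^ n

/-- The observable on `n + 1` replicas whose Gibbs average is the derivative of the Gibbs average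
of `f` when the log-weights move with velocity `h`. -/
def replicaDeriv {n : ℕ} (f : (Fin n → S) → ℝ) (h : S → ℝ) (R : Fin (n + 1) → S) : ℝ :=
  f (fun a => R a.castSucc) * (∑ a : Fin n, h (R a.castSucc) - n * h (R (Fin.last n)))

theorem gibbsAvg_sum [Fintype S] {ι : Type*} (s : Finset ι) {n : ℕ} (w : S → ℝ)
    (f : ι → (Fin n → S) → ℝ) :
    gibbsAvg n w (fun R => ∑ j ∈ s, f j R) = ∑ j ∈ s, gibbsAvg n w (f j) := by
  simp only [gibbsAvg, Finset.mul_sum, ← Finset.sum_div]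
  rw [Finset.sum_comm]

theorem gibbsAvg_const_mul [Fintype S] {n : ℕ} (w : S → ℝ) (c : ℝ) (f : (Fin n → S) → ℝ) :
    gibbsAvg n w (fun R => c * f R) = c * gibbsAvg n w f := by
  simp only [gibbsAvg, ← mul_div_assoc, Finset.mul_sum]
  congr 1
  exact Finset.sum_congr rfl fun R _ => by ring

theorem gibbsAvg_add [Fintype S] {n : ℕ} (w : S → ℝ) (f g : (Fin n → S) → ℝ) :
    gibbsAvg n w (fun R => f R + g R) = gibbsAvg n w f + gibbsAvg n w g := by
  simp only [gibbsAvg, mul_add, Finset.sum_add_distrib, add_div]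

theorem gibbsAvg_comp_perm [Fintype S] {n : ℕ} (w : S → ℝ) (f : (Fin n → S) → ℝ)
    (e : Equiv.Perm (Fin n)) :
    gibbsAvg n w (fun R => f (R ∘ e)) = gibbsAvg n w f := by
  unfold gibbsAvg
  congr 1
  refine Fintype.sum_equiv (e.symm.arrowCongr (Equiv.refl S)) _ _ fun R => ?_
  have hR : e.symm.arrowCongr (Equiv.refl S) R = R ∘ e := rfl
  rw [hR]
  congr 1
  exact (Equiv.prod_comp e fun a => w (R a)).symm

theorem abs_gibbsAvg_le [Fintype S] [Nonempty S] {n : ℕ} {w : S → ℝ} (hw : ∀ σ, 0 < w σ)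
    {f : (Fin n → S) → ℝ} {C : ℝ} (hf : ∀ R, |f R| ≤ C) : |gibbsAvg n w f| ≤ C := by
  have hZ : 0 < ∑ σ, w σ := Finset.sum_pos (fun σ _ => hw σ) Finset.univ_nonempty
  have hpow : (∑ σ, w σ) ^ n = ∑ R : Fin n → S, ∏ a, w (R a) := by
    rw [← Fintype.prod_sum (fun _ : Fin n => w)]
    simp
  rw [gibbsAvg, abs_div, abs_of_pos (pow_pos hZ n), div_le_iff₀ (pow_pos hZ n), hpow,
    Finset.mul_sum]
  refine (Finset.abs_sum_le_sum_abs _ _).trans (Finset.sum_le_sum fun R _ => ?_)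
  have hprod : 0 < ∏ a, w (R a) := Finset.prod_pos fun a _ => hw _
  rw [abs_mul, abs_of_pos hprod, mul_comm]
  exact mul_le_mul_of_nonneg_right (hf R) hprod.le

theorem abs_replicaDeriv_le {n : ℕ} {f : (Fin n → S) → ℝ} {h : S → ℝ} {C H : ℝ}
    (hf : ∀ R, |f R| ≤ C) (hh : ∀ σ, |h σ| ≤ H) (R : Fin (n + 1) → S) :
    |replicaDeriv f h R| ≤ C * (n * H + n * H) := by
  rw [replicaDeriv, abs_mul]
  refine mul_le_mul (hf _) ((abs_sub _ _).trans (add_le_add ?_ ?_)) (abs_nonneg _)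
    ((abs_nonneg _).trans (hf fun a => R a.castSucc))
  · refine (Finset.abs_sum_le_sum_abs _ _).trans ((Finset.sum_le_sum fun a _ => hh _).trans ?_)
    simp
  · rw [abs_mul, Nat.abs_cast]
    exact mul_le_mul_of_nonneg_left (hh _) (Nat.cast_nonneg n)

theorem replicaDeriv_sum_mul {ι : Type*} (s : Finset ι) {n : ℕ} (f : (Fin n → S) → ℝ)
    (x : ι → ℝ) (v : ι → S → ℝ) (R : Fin (n + 1) → S) :
    replicaDeriv f (fun σ => ∑ j ∈ s, x j * v j σ) R = ∑ j ∈ s, x j * replicaDeriv f (v j) R := by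
  simp only [replicaDeriv]
  rw [Finset.sum_comm, Finset.mul_sum, ← Finset.sum_sub_distrib, Finset.mul_sum]
  refine Finset.sum_congr rfl fun j _ => ?_
  rw [← Finset.mul_sum]
  ring

theorem replicaDeriv_const_mul {n : ℕ} (f : (Fin n → S) → ℝ) (c : ℝ) (h : S → ℝ)
    (R : Fin (n + 1) → S) :
    replicaDeriv f (fun σ => c * h σ) R = c * replicaDeriv f h R := by
  simp only [replicaDeriv, ← Finset.mul_sum]
  ring

theorem continuous_gibbsAvg [Fintype S] [Nonempty S] {X : Type*} [TopologicalSpace X] {n : ℕ}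
    {w : X → S → ℝ} (hw : ∀ σ, Continuous fun x => w x σ) (hpos : ∀ x σ, 0 < w x σ)
    {f : X → (Fin n → S) → ℝ} (hf : ∀ R, Continuous fun x => f x R) :
    Continuous fun x => gibbsAvg n (w x) (f x) := by
  unfold gibbsAvg
  refine Continuous.div ?_ ?_ fun x =>
    (pow_pos (Finset.sum_pos (fun σ _ => hpos x σ) Finset.univ_nonempty) n).ne'
  · exact continuous_finsetSum _ fun R _ =>
      (continuous_finsetProd _ fun a _ => hw (R a)).mul (hf R)
  · exact (continuous_finsetSum _ fun σ _ => hw σ).pow n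

theorem hasDerivAt_gibbsAvg [Fintype S] [Nonempty S] {n : ℕ} (f : (Fin n → S) → ℝ) {w : ℝ → S → ℝ}
    {h : S → ℝ} {u : ℝ} (hpos : ∀ σ, 0 < w u σ)
    (hw : ∀ σ, HasDerivAt (fun u => w u σ) (h σ * w u σ) u) :
    HasDerivAt (fun u => gibbsAvg n (w u) f) (gibbsAvg (n + 1) (w u) (replicaDeriv f h)) u := by
  have hZ : (∑ σ, w u σ) ≠ 0 :=
    (Finset.sum_pos (fun σ _ => hpos σ) Finset.univ_nonempty).ne'
  have hprod : ∀ R : Fin n → S, HasDerivAt (fun u => (∏ a, w u (R a)) * f R)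
      ((∑ a, h (R a)) * (∏ a, w u (R a)) * f R) u := by
    intro R
    refine HasDerivAt.mul_const ?_ _
    convert HasDerivAt.fun_finsetProd (u := Finset.univ) (fun a _ => hw (R a)) using 1
    rw [Finset.sum_mul]
    refine Finset.sum_congr rfl fun a _ => ?_
    rw [← Finset.mul_prod_erase _ _ (Finset.mem_univ a), smul_eq_mul]
    ring
  have hnum := HasDerivAt.fun_sum (u := Finset.univ) fun R _ => hprod R
  have hden := (HasDerivAt.fun_sum (u := Finset.univ) fun σ _ => hw σ).fun_pow n
  have hquot := hnum.fun_div hden (pow_ne_zero n hZ)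
  refine hquot.congr_deriv ?_
  have hsplit : ∑ R : Fin (n + 1) → S, (∏ a, w u (R a)) * replicaDeriv f h R =
      (∑ R : Fin n → S, (∑ a, h (R a)) * (∏ a, w u (R a)) * f R) * (∑ σ, w u σ) -
        n * ((∑ R : Fin n → S, (∏ a, w u (R a)) * f R) * ∑ σ, h σ * w u σ) := by
    rw [← Equiv.sum_comp (Fin.snocEquiv fun _ : Fin (n + 1) => S), Fintype.sum_prod_type_right,
      Finset.sum_mul, Finset.sum_mul, Finset.mul_sum, ← Finset.sum_sub_distrib]
    refine Finset.sum_congr rfl fun R _ => ?_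
    rw [Finset.mul_sum, Finset.mul_sum, Finset.mul_sum, ← Finset.sum_sub_distrib]
    refine Finset.sum_congr rfl fun σ _ => ?_
    simp only [Fin.snocEquiv, Equiv.coe_fn_mk, replicaDeriv, Fin.prod_univ_castSucc,
      Fin.snoc_castSucc, Fin.snoc_last]
    ring
  rw [gibbsAvg, hsplit]
  rcases n with _ | n
  · simp
  · simp only [Nat.add_sub_cancel]
    field_simp
    ring

/-- Second replica derivatives summed over a family of directions with Gram kernel `K * c`. -/
theorem sum_gibbsAvg_replicaDeriv_replicaDeriv [Fintype S] {ι : Type*} [Fintype ι] {s : ℕ}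
    (w : S → ℝ) (f : (Fin s → S) → ℝ) (v : ι → S → ℝ) (c : S → S → ℝ) (K : ℝ)
    (hc : ∀ σ σ', ∑ j, v j σ * v j σ' = K * c σ σ') (hc1 : ∀ σ, c σ σ = 1)
    (hsymm : ∀ σ σ', c σ σ' = c σ' σ) :
    ∑ j, gibbsAvg (s + 2) w (replicaDeriv (replicaDeriv f (v j)) (v j)) =
      2 * K * gibbsAvg (s + 2) w (fun R => f (fun a => R a.castSucc.castSucc) *
        ((∑ a : Fin s, ∑ b : Fin s,
            if a.1 < b.1 then c (R a.castSucc.castSucc) (R b.castSucc.castSucc) else 0)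
          - s * ∑ a : Fin s, c (R a.castSucc.castSucc) (R (Fin.last s).castSucc)
          + (s * (s + 1) / 2) * c (R (Fin.last s).castSucc) (R (Fin.last (s + 1))))) := by
  set X : (Fin (s + 2) → S) → ℝ := fun R => f (fun a => R a.castSucc.castSucc) *
    ∑ a : Fin s, c (R a.castSucc.castSucc) (R (Fin.last s).castSucc) with hX
  set Y : (Fin (s + 2) → S) → ℝ := fun R => f (fun a => R a.castSucc.castSucc) *
    ∑ a : Fin s, c (R a.castSucc.castSucc) (R (Fin.last (s + 1))) with hY
  have hXY : gibbsAvg (s + 2) w Y = gibbsAvg (s + 2) w X := by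
    rw [← gibbsAvg_comp_perm w X (Equiv.swap (Fin.last s).castSucc (Fin.last (s + 1)))]
    congr 1
    funext R
    have hfix : ∀ a : Fin s, Equiv.swap (Fin.last s).castSucc (Fin.last (s + 1))
        a.castSucc.castSucc = a.castSucc.castSucc := fun a =>
      Equiv.swap_apply_of_ne_of_ne
        (fun h => (Fin.castSucc_lt_last a).ne (Fin.castSucc_injective _ h))
        (Fin.castSucc_lt_last _).ne
    simp only [hX, hY, Function.comp_apply, hfix, Equiv.swap_apply_left]
  have hdouble : ∀ R : Fin (s + 2) → S,
      ∑ a : Fin s, ∑ b : Fin s, c (R a.castSucc.castSucc) (R b.castSucc.castSucc) =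
        2 * (∑ a : Fin s, ∑ b : Fin s,
          if a.1 < b.1 then c (R a.castSucc.castSucc) (R b.castSucc.castSucc) else 0) + s := by
    intro R
    have hterm : ∀ a b : Fin s, c (R a.castSucc.castSucc) (R b.castSucc.castSucc) =
        (if a.1 < b.1 then c (R a.castSucc.castSucc) (R b.castSucc.castSucc) else 0) +
        (if b.1 < a.1 then c (R b.castSucc.castSucc) (R a.castSucc.castSucc) else 0) +
        (if a = b then 1 else 0) := by
      intro a b
      rcases lt_trichotomy a b with h | h | h
      · simp [h, h.ne, h.not_gt]
      · subst h
        simp [hc1]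
      · simp [h, h.ne', h.not_gt, hsymm (R a.castSucc.castSucc)]
    rw [Finset.sum_congr rfl fun a _ => Finset.sum_congr rfl fun b _ => hterm a b]
    simp only [Finset.sum_add_distrib]
    rw [Finset.sum_comm (f := fun a b : Fin s => if b.1 < a.1 then _ else _)]
    simp
    ring
  have hpoint : ∀ R : Fin (s + 2) → S,
      ∑ j, replicaDeriv (replicaDeriv f (v j)) (v j) R =
      2 * K * (f (fun a => R a.castSucc.castSucc) *
        ((∑ a : Fin s, ∑ b : Fin s,
            if a.1 < b.1 then c (R a.castSucc.castSucc) (R b.castSucc.castSucc) else 0)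
          - s * ∑ a : Fin s, c (R a.castSucc.castSucc) (R (Fin.last s).castSucc)
          + (s * (s + 1) / 2) * c (R (Fin.last s).castSucc) (R (Fin.last (s + 1))))) +
        (K * (s + 1) * X R + (-(K * (s + 1))) * Y R) := by
    intro R
    have e1 : K * ∑ a : Fin s, ∑ b : Fin s, c (R a.castSucc.castSucc) (R b.castSucc.castSucc) =
        ∑ j, (∑ a : Fin s, v j (R a.castSucc.castSucc)) *
          (∑ a : Fin s, v j (R a.castSucc.castSucc)) := by
      simp only [Finset.sum_mul_sum]
      simp only [Finset.mul_sum, ← hc]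
      rw [Finset.sum_comm_cycle]
    have e2 : ∀ σ, K * ∑ a : Fin s, c (R a.castSucc.castSucc) σ =
        ∑ j, (∑ a : Fin s, v j (R a.castSucc.castSucc)) * v j σ := by
      intro σ
      simp only [Finset.sum_mul, Finset.mul_sum, ← hc]
      rw [Finset.sum_comm]
    have hexpand : ∀ j, replicaDeriv (replicaDeriv f (v j)) (v j) R =
        f (fun a => R a.castSucc.castSucc) * (
          (∑ a : Fin s, v j (R a.castSucc.castSucc)) * (∑ a : Fin s, v j (R a.castSucc.castSucc))
          + (1 - s) * ((∑ a : Fin s, v j (R a.castSucc.castSucc)) * v j (R (Fin.last s).castSucc))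
          + (-(s + 1)) *
            ((∑ a : Fin s, v j (R a.castSucc.castSucc)) * v j (R (Fin.last (s + 1))))
          + (-s) * (v j (R (Fin.last s).castSucc) * v j (R (Fin.last s).castSucc))
          + s * (s + 1) * (v j (R (Fin.last s).castSucc) * v j (R (Fin.last (s + 1))))) := by
      intro j
      simp only [replicaDeriv, Fin.sum_univ_castSucc (n := s), Nat.cast_add, Nat.cast_one]
      ring
    simp only [hexpand, ← Finset.mul_sum, Finset.sum_add_distrib]
    rw [← e1, ← e2, ← e2, hc, hc, hc1, hdouble R]
    simp only [hX, hY]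
    ring
  rw [← gibbsAvg_sum]
  simp only [hpoint]
  rw [gibbsAvg_add, gibbsAvg_add, gibbsAvg_const_mul, gibbsAvg_const_mul, gibbsAvg_const_mul, hXY]
  ring

end Gibbs

/-- The coefficient `τ_k σ_i` of the coupling `J̃_{ik}` in the cavity Hamiltonian. -/
def spinProduct {N M : ℕ} (j : Fin N × Fin M) (στ : (Fin N → Bool) × (Fin M → Bool)) : ℝ :=
  spinval (στ.2 j.2) * spinval (στ.1 j.1)

instance (N M : ℕ) : IsProbabilityMeasure (couplingLaw N M) := by
  unfold couplingLaw
  infer_instance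

theorem spinval_mul_self (b : Bool) : spinval b * spinval b = 1 := by
  cases b <;> simp [spinval]

theorem abs_spinval (b : Bool) : |spinval b| = 1 := by
  cases b <;> simp [spinval]

theorem abs_spinProduct {N M : ℕ} (j : Fin N × Fin M) (στ : (Fin N → Bool) × (Fin M → Bool)) :
    |spinProduct j στ| = 1 := by
  simp [spinProduct, abs_mul, abs_spinval]

theorem sum_spinProduct_mul {N M : ℕ} (hN : 1 ≤ N) (hM : 1 ≤ M)
    (στ στ' : (Fin N → Bool) × (Fin M → Bool)) :
    ∑ j, spinProduct j στ * spinProduct j στ' =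
      N * M * (ovlp N στ.1 στ'.1 * ovlp M στ.2 στ'.2) := by
  have hN' : (N : ℝ) ≠ 0 := by positivity
  have hM' : (M : ℝ) ≠ 0 := by positivity
  have hprod : ∑ j : Fin N × Fin M, spinProduct j στ * spinProduct j στ' =
      (∑ i, spinval (στ.1 i) * spinval (στ'.1 i)) *
        ∑ k, spinval (στ.2 k) * spinval (στ'.2 k) := by
    rw [Finset.sum_mul_sum, Fintype.sum_prod_type]
    refine Finset.sum_congr rfl fun i _ => Finset.sum_congr rfl fun k _ => ?_
    simp only [spinProduct]
    ring
  rw [hprod, ovlp, ovlp]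
  field_simp

theorem ovlp_self {N : ℕ} (hN : 1 ≤ N) (σ : Fin N → Bool) : ovlp N σ σ = 1 := by
  have hN' : (N : ℝ) ≠ 0 := by positivity
  simp [ovlp, spinval_mul_self, hN']

theorem cavityWeight_eq (N M : ℕ) (β t : ℝ)
    (J : ((Fin M × Fin M) → ℝ) × ((Fin N × Fin M) → ℝ))
    (στ : (Fin N → Bool) × (Fin M → Bool)) :
    cavityWeight N M β t J στ =
      Real.exp ((β / Real.sqrt M) * ∑ k : Fin M, ∑ l : Fin M,
          J.1 (k, l) * spinval (στ.2 k) * spinval (στ.2 l)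
        + Real.sqrt (t / ((N : ℝ) * (M : ℝ))) * ∑ j, J.2 j * spinProduct j στ) := by
  simp only [cavityWeight, Fintype.sum_prod_type, spinProduct, mul_assoc]

theorem cavityWeight_pos (N M : ℕ) (β t : ℝ)
    (J : ((Fin M × Fin M) → ℝ) × ((Fin N × Fin M) → ℝ))
    (στ : (Fin N → Bool) × (Fin M → Bool)) : 0 < cavityWeight N M β t J στ :=
  Real.exp_pos _

theorem continuous_cavityWeight (N M : ℕ) (β t : ℝ) (στ : (Fin N → Bool) × (Fin M → Bool)) :
    Continuous fun J => cavityWeight N M β t J στ := by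
  unfold cavityWeight
  fun_prop

theorem hasDerivAt_cavityWeight_time (N M : ℕ) (β : ℝ) {t : ℝ} (ht : t / ((N : ℝ) * M) ≠ 0)
    (J : ((Fin M × Fin M) → ℝ) × ((Fin N × Fin M) → ℝ))
    (στ : (Fin N → Bool) × (Fin M → Bool)) :
    HasDerivAt (fun t => cavityWeight N M β t J στ)
      ((∑ j, (1 / ((N : ℝ) * M) / (2 * Real.sqrt (t / ((N : ℝ) * M))) * J.2 j) *
        spinProduct j στ) * cavityWeight N M β t J στ) t := by
  simp only [cavityWeight_eq]
  refine ((((((hasDerivAt_id t).div_const _).sqrt ht).mul_const _).const_add _).exp).congr_deriv ?_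
  simp only [mul_assoc, ← Finset.mul_sum, id_eq]
  ring

theorem hasDerivAt_cavityWeight_coupling (N M : ℕ) (β t : ℝ) (j : Fin N × Fin M)
    (J : ((Fin M × Fin M) → ℝ) × ((Fin N × Fin M) → ℝ))
    (στ : (Fin N → Bool) × (Fin M → Bool)) :
    HasDerivAt (fun y => cavityWeight N M β t (J.1, Function.update J.2 j y) στ)
      ((Real.sqrt (t / ((N : ℝ) * M)) * spinProduct j στ) * cavityWeight N M β t J στ)
      (J.2 j) := by
  have hsum : HasDerivAt (fun y => ∑ j', Function.update J.2 j y j' * spinProduct j' στ)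
      (∑ j', (Pi.single j 1 : Fin N × Fin M → ℝ) j' * spinProduct j' στ) (J.2 j) :=
    HasDerivAt.fun_sum fun j' _ =>
      (hasDerivAt_pi.1 (hasDerivAt_update J.2 j (J.2 j)) j').mul_const _
  simp only [cavityWeight_eq]
  refine (((hsum.const_mul _).const_add _).exp).congr_deriv ?_
  simp [Pi.single_apply]
  ring

/-- Gaussian integration by parts for replicated Gibbs averages. -/
theorem integral_coupling_mul_gibbsAvg (N M : ℕ) (β t : ℝ) (j : Fin N × Fin M) {n : ℕ}
    (f : (Fin n → (Fin N → Bool) × (Fin M → Bool)) → ℝ) :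
    ∫ J, J.2 j * gibbsAvg n (cavityWeight N M β t J) f ∂couplingLaw N M =
      ∫ J, Real.sqrt (t / ((N : ℝ) * M)) *
        gibbsAvg (n + 1) (cavityWeight N M β t J) (replicaDeriv f (spinProduct j))
        ∂couplingLaw N M := by
  have hbdd : ∀ {m : ℕ} (g : (Fin m → (Fin N → Bool) × (Fin M → Bool)) → ℝ) R,
      |g R| ≤ ∑ R, |g R| := fun g R =>
    Finset.single_le_sum (f := fun R => |g R|) (fun R _ => abs_nonneg _) (Finset.mem_univ R)
  have hcont : ∀ {m : ℕ} (g : (Fin m → (Fin N → Bool) × (Fin M → Bool)) → ℝ),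
      Continuous fun J => gibbsAvg m (cavityWeight N M β t J) g := fun g =>
    continuous_gibbsAvg (continuous_cavityWeight N M β t) (cavityWeight_pos N M β t)
      fun _ => continuous_const
  conv_rhs => simp only [← gibbsAvg_const_mul, ← replicaDeriv_const_mul]
  set f' := replicaDeriv f fun σ => Real.sqrt (t / ((N : ℝ) * M)) * spinProduct j σ
  refine integral_apply_mul_prod_pi_gaussianReal
    (Measure.pi fun _ : Fin M × Fin M => gaussianReal 0 1) j
    (hcont f).measurable (hcont f').measurable
    (C := max (∑ R, |f R|) (∑ R, |f' R|))
    (fun J => abs_gibbsAvg_le (cavityWeight_pos N M β t J)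
      fun R => (hbdd f R).trans (le_max_left _ _))
    (fun J => abs_gibbsAvg_le (cavityWeight_pos N M β t J)
      fun R => (hbdd f' R).trans (le_max_right _ _)) fun J => ?_
  have hder := hasDerivAt_gibbsAvg f
    (w := fun y => cavityWeight N M β t (J.1, Function.update J.2 j y)) (u := J.2 j)
    (h := fun σ => Real.sqrt (t / ((N : ℝ) * M)) * spinProduct j σ)
    (fun σ => cavityWeight_pos _ _ _ _ _ _)
    (fun σ => by simpa using hasDerivAt_cavityWeight_coupling N M β t j J σ)
  simpa using hder

/-- Differentiation of replicated Gibbs averages with respect to the cavity time. -/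
theorem hasDerivAt_replicaAvg {N M : ℕ} (hN : 1 ≤ N) (hM : 1 ≤ M) (β : ℝ) {t : ℝ} (ht : 0 < t)
    {n : ℕ} (f : (Fin n → (Fin N → Bool) × (Fin M → Bool)) → ℝ) :
    HasDerivAt (fun t => replicaAvg n N M β t f)
      (∫ J, ∑ j, (1 / ((N : ℝ) * M) / (2 * Real.sqrt (t / ((N : ℝ) * M))) * J.2 j) *
        gibbsAvg (n + 1) (cavityWeight N M β t J) (replicaDeriv f (spinProduct j))
        ∂couplingLaw N M) t := by
  have hNM : (0 : ℝ) < N * M := by positivity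
  set κ : ℝ → ℝ := fun t => 1 / ((N : ℝ) * M) / (2 * Real.sqrt (t / ((N : ℝ) * M))) with hκ
  have hf : ∀ R, |f R| ≤ ∑ R, |f R| := fun R =>
    Finset.single_le_sum (f := fun R => |f R|) (fun R _ => abs_nonneg _) (Finset.mem_univ R)
  have hcoord : ∀ j, Integrable (fun J => J.2 j) (couplingLaw N M) := fun j =>
    (integrable_apply_pi_gaussianReal j).comp_snd _
  have hmeas : ∀ {m : ℕ} (t : ℝ)
      (g : ((Fin M × Fin M) → ℝ) × ((Fin N × Fin M) → ℝ) →
        (Fin m → (Fin N → Bool) × (Fin M → Bool)) → ℝ), (∀ R, Continuous fun J => g J R) →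
      AEStronglyMeasurable (fun J => gibbsAvg m (cavityWeight N M β t J) (g J))
        (couplingLaw N M) := fun t g hg =>
    (continuous_gibbsAvg (continuous_cavityWeight N M β t) (cavityWeight_pos N M β t)
      hg).aestronglyMeasurable
  have hprodInt : Integrable (fun J => gibbsAvg n (cavityWeight N M β t J) f) (couplingLaw N M) :=
    Integrable.of_bound (hmeas t (fun _ => f) fun _ => continuous_const) _
      (ae_of_all _ fun J => abs_gibbsAvg_le (cavityWeight_pos N M β t J) hf)
  have hmeas' : AEStronglyMeasurable (fun J => gibbsAvg (n + 1) (cavityWeight N M β t J)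
      (replicaDeriv f fun σ => ∑ j, (κ t * J.2 j) * spinProduct j σ)) (couplingLaw N M) := by
    refine hmeas t _ fun R => ?_
    unfold replicaDeriv
    fun_prop
  have hbound : ∀ J, ∀ t' ∈ Set.Ioi (t / 2), ‖gibbsAvg (n + 1) (cavityWeight N M β t' J)
      (replicaDeriv f fun σ => ∑ j, (κ t' * J.2 j) * spinProduct j σ)‖ ≤ (∑ R, |f R|) *
      (n * (∑ j, κ (t / 2) * |J.2 j|) + n * ∑ j, κ (t / 2) * |J.2 j|) := by
    intro J t' ht'
    refine abs_gibbsAvg_le (cavityWeight_pos N M β t' J) (abs_replicaDeriv_le hf fun σ => ?_)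
    have hκ0 : 0 ≤ κ t' := by positivity
    have hκle : κ t' ≤ κ (t / 2) := by
      have h1 : 0 < Real.sqrt (t / 2 / ((N : ℝ) * M)) := by positivity
      have h2 : t / 2 ≤ t' := le_of_lt ht'
      simp only [hκ]
      gcongr
    refine (Finset.abs_sum_le_sum_abs _ _).trans (Finset.sum_le_sum fun j _ => ?_)
    rw [abs_mul, abs_spinProduct, mul_one, abs_mul, abs_of_nonneg hκ0]
    exact mul_le_mul_of_nonneg_right hκle (abs_nonneg _)
  have hboundInt : Integrable (fun J => (∑ R, |f R|) *
      (n * (∑ j, κ (t / 2) * |J.2 j|) + n * ∑ j, κ (t / 2) * |J.2 j|)) (couplingLaw N M) := by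
    have hsum : Integrable (fun J => ∑ j, κ (t / 2) * |J.2 j|) (couplingLaw N M) :=
      integrable_finsetSum _ fun j _ => (hcoord j).abs.const_mul _
    exact ((hsum.const_mul _).add (hsum.const_mul _)).const_mul _
  have hdiff : ∀ J, ∀ t' ∈ Set.Ioi (t / 2),
      HasDerivAt (fun t => gibbsAvg n (cavityWeight N M β t J) f)
        (gibbsAvg (n + 1) (cavityWeight N M β t' J)
          (replicaDeriv f fun σ => ∑ j, (κ t' * J.2 j) * spinProduct j σ)) t' := by
    intro J t' ht'
    have ht'0 : 0 < t' := lt_trans (half_pos ht) ht'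
    exact hasDerivAt_gibbsAvg f (cavityWeight_pos N M β t' J)
      fun σ => hasDerivAt_cavityWeight_time N M β (div_pos ht'0 hNM).ne' J σ
  have hmain := (hasDerivAt_integral_of_dominated_loc_of_deriv_le
    (Ioi_mem_nhds (half_lt_self ht))
    (Eventually.of_forall fun t => hmeas t (fun _ => f) fun _ => continuous_const)
    hprodInt hmeas' (ae_of_all _ hbound) hboundInt (ae_of_all _ hdiff)).2
  have hlin : ∀ J : ((Fin M × Fin M) → ℝ) × ((Fin N × Fin M) → ℝ),
      gibbsAvg (n + 1) (cavityWeight N M β t J)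
        (replicaDeriv f fun σ => ∑ j, (κ t * J.2 j) * spinProduct j σ) =
      ∑ j, (κ t * J.2 j) *
        gibbsAvg (n + 1) (cavityWeight N M β t J) (replicaDeriv f (spinProduct j)) := by
    intro J
    simp only [← gibbsAvg_const_mul]
    rw [← gibbsAvg_sum]
    congr 1
    funext R
    exact replicaDeriv_sum_mul _ _ _ _ _
  exact hmain.congr_deriv (integral_congr_ae (ae_of_all _ hlin))

theorem integrable_gibbsAvg_cavityWeight (N M : ℕ) (β t : ℝ) {n : ℕ}
    (f : (Fin n → (Fin N → Bool) × (Fin M → Bool)) → ℝ) :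
    Integrable (fun J => gibbsAvg n (cavityWeight N M β t J) f) (couplingLaw N M) :=
  Integrable.of_bound (continuous_gibbsAvg (f := fun _ => f) (continuous_cavityWeight N M β t)
    (cavityWeight_pos N M β t) fun _ => continuous_const).aestronglyMeasurable (∑ R, |f R|)
    (ae_of_all _ fun J => abs_gibbsAvg_le (cavityWeight_pos N M β t J) fun R =>
      Finset.single_le_sum (f := fun R => |f R|) (fun _ _ => abs_nonneg _) (Finset.mem_univ R))

theorem integrable_coupling_mul_gibbsAvg (N M : ℕ) (β t : ℝ) (j : Fin N × Fin M) {n : ℕ}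
    (f : (Fin n → (Fin N → Bool) × (Fin M → Bool)) → ℝ) :
    Integrable (fun J => J.2 j * gibbsAvg n (cavityWeight N M β t J) f) (couplingLaw N M) := by
  have hcoord : Integrable (fun J => J.2 j) (couplingLaw N M) :=
    (integrable_apply_pi_gaussianReal j).comp_snd _
  refine hcoord.mul_bdd (integrable_gibbsAvg_cavityWeight N M β t f).aestronglyMeasurable
    (c := ∑ R, |f R|) (ae_of_all _ fun J => ?_)
  exact abs_gibbsAvg_le (cavityWeight_pos N M β t J) fun R =>
    Finset.single_le_sum (f := fun R => |f R|) (fun _ _ => abs_nonneg _) (Finset.mem_univ R)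

/-- The streaming equation for an arbitrary observable of finitely many replicas. -/
theorem hasDerivAt_replicaAvg_overlap {N M : ℕ} (hN : 1 ≤ N) (hM : 1 ≤ M) (β : ℝ) {t : ℝ}
    (ht : 0 < t) {s : ℕ} (f : (Fin s → (Fin N → Bool) × (Fin M → Bool)) → ℝ)
    (c : (Fin N → Bool) × (Fin M → Bool) → (Fin N → Bool) × (Fin M → Bool) → ℝ)
    (hc : c = fun στ στ' => ovlp N στ.1 στ'.1 * ovlp M στ.2 στ'.2) :
    HasDerivAt (fun t => replicaAvg s N M β t f)
      (replicaAvg (s + 2) N M β t fun R => f (fun a => R a.castSucc.castSucc) *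
        ((∑ a : Fin s, ∑ b : Fin s,
            if a.1 < b.1 then c (R a.castSucc.castSucc) (R b.castSucc.castSucc) else 0)
          - s * ∑ a : Fin s, c (R a.castSucc.castSucc) (R (Fin.last s).castSucc)
          + (s * (s + 1) / 2) * c (R (Fin.last s).castSucc) (R (Fin.last (s + 1))))) t := by
  have hNM : (0 : ℝ) < N * M := by positivity
  have hr : 0 < Real.sqrt (t / ((N : ℝ) * M)) := by positivity
  refine (hasDerivAt_replicaAvg hN hM β ht f).congr_deriv ?_
  simp only [mul_assoc, ← Finset.mul_sum]
  rw [integral_const_mul, integral_finsetSum _ fun j _ =>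
    integrable_coupling_mul_gibbsAvg N M β t j (replicaDeriv f (spinProduct j))]
  simp only [integral_coupling_mul_gibbsAvg]
  rw [← integral_finsetSum _ fun j _ => (integrable_gibbsAvg_cavityWeight N M β t
    (replicaDeriv (replicaDeriv f (spinProduct j)) (spinProduct j))).const_mul _,
    ← integral_const_mul]
  refine integral_congr_ae (ae_of_all _ fun J => ?_)
  beta_reduce
  rw [← Finset.mul_sum, sum_gibbsAvg_replicaDeriv_replicaDeriv (cavityWeight N M β t J) f
    spinProduct c (N * M)
    (fun σ σ' => by rw [hc]; exact sum_spinProduct_mul hN hM σ σ')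
    (fun σ => by simp [hc, ovlp_self hN, ovlp_self hM])
    (fun σ σ' => by simp only [hc, ovlp, mul_comm])]
  have hcoef : 1 / ((N : ℝ) * M) / (2 * Real.sqrt (t / ((N : ℝ) * M))) *
      Real.sqrt (t / ((N : ℝ) * M)) * (2 * (N * M)) = 1 := by
    field_simp
  rw [← mul_assoc, ← mul_assoc, hcoef, one_mul]
  rfl

/-- Cavity streaming equation: for a function `F` of the overlap arrays of the first `s`
replicas, `d/dt ⟨F⟩_t = ⟨F·(Σ_{a<b≤s} q_ab q̃_ab − s Σ_{a≤s} q_{a,s+1} q̃_{a,s+1}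
+ (s(s+1)/2) q_{s+1,s+2} q̃_{s+1,s+2})⟩_t`. -/
theorem cavity_streaming_equation (N M : ℕ) (hN : 1 ≤ N) (hM : 1 ≤ M)
    (β : ℝ) (hβ : 0 ≤ β) (s : ℕ) (hs : 1 ≤ s)
    (F : (Fin s → Fin s → ℝ) → (Fin s → Fin s → ℝ) → ℝ)
    (t : ℝ) (ht : 0 < t) :
    HasDerivAt
      (fun t' => replicaAvg s N M β t' (fun R =>
        F (fun a b => ovlp N (R a).1 (R b).1) (fun a b => ovlp M (R a).2 (R b).2)))
      (replicaAvg (s + 2) N M β t (fun R =>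
        F (fun a b => ovlp N (R ⟨a.1, by omega⟩).1 (R ⟨b.1, by omega⟩).1)
          (fun a b => ovlp M (R ⟨a.1, by omega⟩).2 (R ⟨b.1, by omega⟩).2) *
        ((∑ a : Fin s, ∑ b : Fin s, if a.1 < b.1 then
            ovlp N (R ⟨a.1, by omega⟩).1 (R ⟨b.1, by omega⟩).1 *
            ovlp M (R ⟨a.1, by omega⟩).2 (R ⟨b.1, by omega⟩).2 else 0)
          - (s : ℝ) * ∑ a : Fin s,
              ovlp N (R ⟨a.1, by omega⟩).1 (R ⟨s, by omega⟩).1 *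
              ovlp M (R ⟨a.1, by omega⟩).2 (R ⟨s, by omega⟩).2
          + ((s : ℝ) * ((s : ℝ) + 1) / 2) *
              (ovlp N (R ⟨s, by omega⟩).1 (R ⟨s + 1, by omega⟩).1 *
               ovlp M (R ⟨s, by omega⟩).2 (R ⟨s + 1, by omega⟩).2))))
      t := by
  refine (hasDerivAt_replicaAvg_overlap hN hM β ht (fun R =>
    F (fun a b => ovlp N (R a).1 (R b).1) (fun a b => ovlp M (R a).2 (R b).2)) _ rfl).congr_deriv ?_
  exact congrArg (replicaAvg (s + 2) N M β t) (funext fun R => rfl)
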